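/- The upsilon product Υ, extended bilinearly to U = ⊕_{x,y} U_x^y (the direct sum over all pairs of positive-integer leaf sequences of the modules of monomials, with Υ(A⊗B) := 0 whenever (A,B) is not a block transverse pair), is an associative product: for all monomials A, B, C in U one has Υ(Υ(A⊗B)⊗C) = Υ(A⊗Υ(B⊗C)). -/

import Mathlib

open scoped TensorProduct DirectSum

section Core

variable {R : Type*} [CommRing R] {H : Type*} [AddCommGroup H] [Module R H]

/-- Transport of tensor powers along an equality of exponents (a canonical reindexing). -/
noncomputable def tpCast {a b : ℕ} (h : a = b) : (⨂[R]^(a) H) ≃ₗ[R] (⨂[R]^(b) H) :=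
  PiTensorProduct.reindex R (fun _ : Fin a => H) (finCongr h)

/-- The canonical splitting `H^{⊗(a+b)} ≅ H^{⊗a} ⊗ H^{⊗b}`. -/
noncomputable def splitPow (a b : ℕ) :
    (⨂[R]^(a + b) H) ≃ₗ[R] ((⨂[R]^(a) H) ⊗[R] (⨂[R]^(b) H)) :=
  (TensorPower.mulEquiv (R := R) (M := H) (n := a) (m := b)).symm

/-- Tensor product of a family of maps `H^{⊗ n j} → H^{⊗ g j}` (j = 0, …, m-1), realized as a
map `H^{⊗(n 0 + ⋯ + n (m-1))} → H^{⊗(g 0 + ⋯ + g (m-1))}` via the canonical identifications;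
the `j`-th block of consecutive factors is transformed by the `j`-th map. -/
noncomputable def blockMap : ∀ {m : ℕ} (n g : Fin m → ℕ),
    (∀ j, (⨂[R]^(n j) H) →ₗ[R] (⨂[R]^(g j) H)) →
      ((⨂[R]^(∑ j, n j) H) →ₗ[R] (⨂[R]^(∑ j, g j) H))
  | 0, n, g, _ => (tpCast (by simp)).toLinearMap
  | m + 1, n, g, f =>
      (tpCast (Fin.sum_univ_succ g).symm).toLinearMap
        ∘ₗ (splitPow (g 0) (∑ j : Fin m, g j.succ)).symm.toLinearMap
        ∘ₗ (TensorProduct.map (f 0)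
              (blockMap (fun j => n j.succ) (fun j => g j.succ) (fun j => f j.succ)))
        ∘ₗ (splitPow (n 0) (∑ j : Fin m, n j.succ)).toLinearMap
        ∘ₗ (tpCast (Fin.sum_univ_succ n)).toLinearMap

/-- The transposition permutation underlying `σ_{q,p}`: position `k + q·j` (element `k` of
block `j`, in `p` blocks of size `q`) goes to position `j + p·k` (element `j` of block `k`,
in `q` blocks of size `p`). -/
def transposePerm (p q : ℕ) : Fin (∑ _j : Fin p, q) ≃ Fin (∑ _k : Fin q, p) :=
  ((finCongr (by simp [mul_comm])).trans
    (finProdFinEquiv (m := p) (n := q)).symm).trans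
    (((Equiv.prodComm (Fin p) (Fin q)).trans (finProdFinEquiv (m := q) (n := p))).trans
      (finCongr (by simp [mul_comm])))

/-- The canonical permutation of tensor factors `σ_{q,p} : (H^{⊗q})^{⊗p} ≅ (H^{⊗p})^{⊗q}`,
realized on the flattened tensor powers. -/
noncomputable def sigmaPow (p q : ℕ) :
    (⨂[R]^(∑ _j : Fin p, q) H) ≃ₗ[R] (⨂[R]^(∑ _k : Fin q, p) H) :=
  PiTensorProduct.reindex R (fun _ => H) (transposePerm p q)

/-- The composition product `γ(A ⊗ B)` of a transverse pair: `A` is a `q'×1` monomial in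
`U_{p'}^{yB}` and `B` is a `1×p'` monomial in `U_{xB}^{q'}`;
`γ(A⊗B) = (A 0 ⊗ ⋯ ⊗ A (q'-1)) ∘ σ_{q',p'} ∘ (B 0 ⊗ ⋯ ⊗ B (p'-1)) ∈ U_{|xB|}^{|yB|}`. -/
noncomputable def gammaTP {p' q' : ℕ} (xB : Fin p' → ℕ) (yB : Fin q' → ℕ)
    (A : ∀ k : Fin q', (⨂[R]^(p') H) →ₗ[R] (⨂[R]^(yB k) H))
    (B : ∀ j : Fin p', (⨂[R]^(xB j) H) →ₗ[R] (⨂[R]^(q') H)) :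
    (⨂[R]^(∑ j, xB j) H) →ₗ[R] (⨂[R]^(∑ k, yB k) H) :=
  blockMap (fun _ => p') yB A
    ∘ₗ (sigmaPow p' q').toLinearMap
    ∘ₗ blockMap xB (fun _ => q') B

/-- The global index (within a linearly ordered index set partitioned into consecutive blocks of
sizes `u i`) of the `r`-th element of the `i`-th block. -/
def blkIdx {t : ℕ} (u : Fin t → ℕ) (i : Fin t) (r : Fin (u i)) : Fin (∑ i', u i') :=
  ⟨(∑ i' ∈ Finset.Iio i, u i') + r.1, by
    have h1 : (∑ i' ∈ Finset.Iio i, u i') + r.1 < ∑ i' ∈ Finset.Iic i, u i' := by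
      rw [← Finset.Iio_insert, Finset.sum_insert (by simp)]
      have := r.2
      omega
    exact h1.trans_le (Finset.sum_le_sum_of_subset (Finset.subset_univ _))⟩

end Core

/-!
STATEMENT 3: Associativity of the upsilon product.

A leaf sequence is a finite sequence of (positive) natural numbers; a monomial with
coderivation leaf sequence `c` and derivation leaf sequence `d` is a `d.1 × c.1` matrix
whose `(k,j)` entry lies in `U_{d.2 k, c.2 j} = Hom(H^{⊗ c.2 j}, H^{⊗ d.2 k})`.
`U = ⊕_{x,y} U_x^y` is the direct sum over all pairs of leaf sequences, and `Υ` is defined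
on a pair of monomials by applying `γ` blockwise if the pair is a block transverse pair
(`Υ(A⊗B)` is then again a monomial) and by `Υ(A⊗B) := 0` otherwise.

CLAIM: `Υ` is associative: `Υ(Υ(A⊗B)⊗C) = Υ(A⊗Υ(B⊗C))` in `U` for all monomials `A,B,C`.
-/

/-- A leaf sequence: a finite sequence of natural numbers. -/
abbrev LeafSeq : Type := Σ n : ℕ, Fin n → ℕ

/-- A leaf sequence is admissible when it is nonempty and consists of positive integers. -/
def LeafSeq.Pos (c : LeafSeq) : Prop := 0 < c.1 ∧ ∀ j, 0 < c.2 j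

/-- The space of monomials (matrices) with coderivation leaf sequence `c` and derivation
leaf sequence `d`: the `(k,j)` entry lies in `U_{d.2 k, c.2 j} = Hom(H^{⊗c.2 j}, H^{⊗d.2 k})`. -/
abbrev Mon' (R : Type*) [CommRing R] (H : Type*) [AddCommGroup H] [Module R H]
    (c d : LeafSeq) : Type _ :=
  ∀ (k : Fin d.1) (j : Fin c.1), (⨂[R]^(c.2 j) H) →ₗ[R] (⨂[R]^(d.2 k) H)

/-- A monomial together with its pair of leaf sequences. -/
abbrev MonD (R : Type*) [CommRing R] (H : Type*) [AddCommGroup H] [Module R H] : Type _ :=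
  Σ (c : LeafSeq) (d : LeafSeq), Mon' R H c d

/-- The bigraded module `U = ⊕_{x,y} U_x^y` (monomial components). -/
abbrev UMod (R : Type*) [CommRing R] (H : Type*) [AddCommGroup H] [Module R H] : Type _ :=
  ⨁ cd : LeafSeq × LeafSeq, Mon' R H cd.1 cd.2

/-- A monomial (or the formal zero `none`) as an element of `U`. -/
noncomputable def toU {R : Type*} [CommRing R] {H : Type*} [AddCommGroup H] [Module R H] :
    Option (MonD R H) → UMod R H
  | none => 0
  | some a => DirectSum.of (fun cd : LeafSeq × LeafSeq => Mon' R H cd.1 cd.2) (a.1, a.2.1) a.2.2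

/-- The upsilon product of two monomials: if `(A, B)` is a block transverse pair (i.e. the
number of rows of `A` is the total of the derivation leaf sequence of `B` and the number of
columns of `B` is the total of the coderivation leaf sequence of `A`), apply `γ` blockwise,
which produces again a monomial; otherwise the product is zero (`none`). -/
noncomputable def upsM {R : Type*} [CommRing R] {H : Type*} [AddCommGroup H] [Module R H]
    (a b : MonD R H) : Option (MonD R H) :=
  if h : a.2.1.1 = ∑ i, b.2.1.2 i ∧ b.1.1 = ∑ ℓ, a.1.2 ℓ then
    some ⟨⟨a.1.1, fun ℓ => ∑ j : Fin (a.1.2 ℓ), b.1.2 (Fin.cast h.2.symm (blkIdx a.1.2 ℓ j))⟩,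
      ⟨b.2.1.1, fun i => ∑ r : Fin (b.2.1.2 i), a.2.1.2 (Fin.cast h.1.symm (blkIdx b.2.1.2 i r))⟩,
      fun i ℓ => gammaTP
        (fun j => b.1.2 (Fin.cast h.2.symm (blkIdx a.1.2 ℓ j)))
        (fun r => a.2.1.2 (Fin.cast h.1.symm (blkIdx b.2.1.2 i r)))
        (fun r => a.2.2 (Fin.cast h.1.symm (blkIdx b.2.1.2 i r)) ℓ)
        (fun j => b.2.2 i (Fin.cast h.2.symm (blkIdx a.1.2 ℓ j)))⟩
  else none

/-- The upsilon product extended to formal zeroes. -/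
noncomputable def upsO {R : Type*} [CommRing R] {H : Type*} [AddCommGroup H] [Module R H]
    (oa ob : Option (MonD R H)) : Option (MonD R H) :=
  oa.bind fun a => ob.bind fun b => upsM a b

section BlockIndex

variable {t : ℕ} (u : Fin t → ℕ)

theorem blkIdx_lt_blkIdx_of_lt {i i' : Fin t} (h : i < i') (r : Fin (u i)) (r' : Fin (u i')) :
    blkIdx u i r < blkIdx u i' r' := by
  rw [Fin.lt_def]
  have h1 : ∑ k ∈ Finset.Iic i, u k ≤ ∑ k ∈ Finset.Iio i', u k :=
    Finset.sum_le_sum_of_subset fun k hk =>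
      Finset.mem_Iio.2 ((Finset.mem_Iic.1 hk).trans_lt h)
  rw [← Finset.Iio_insert, Finset.sum_insert (by simp)] at h1
  have := r.2
  simp only [blkIdx]
  omega

theorem blkIdx_lt_blkIdx_iff_same (i : Fin t) (r r' : Fin (u i)) :
    blkIdx u i r < blkIdx u i r' ↔ r < r' := by
  rw [Fin.lt_def]
  simp [blkIdx]

theorem blkIdx_bijective :
    Function.Bijective (fun x : Σ i, Fin (u i) => blkIdx u x.1 x.2) := by
  rw [Fintype.bijective_iff_injective_and_card]
  refine ⟨?_, by simp⟩
  rintro ⟨i, r⟩ ⟨i', r'⟩ h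
  dsimp only at h
  rcases lt_trichotomy i i' with hi | rfl | hi
  · exact absurd h (blkIdx_lt_blkIdx_of_lt u hi r r').ne
  · rcases lt_trichotomy r r' with hr | rfl | hr
    · exact absurd h ((blkIdx_lt_blkIdx_iff_same u i r r').2 hr).ne
    · rfl
    · exact absurd h ((blkIdx_lt_blkIdx_iff_same u i r' r).2 hr).ne'
  · exact absurd h (blkIdx_lt_blkIdx_of_lt u hi r' r).ne'

/-- The partition of `Fin (∑ i, u i)` into consecutive blocks, as an equivalence. -/
noncomputable def blkEquiv : (Σ i, Fin (u i)) ≃ Fin (∑ i, u i) :=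
  Equiv.ofBijective _ (blkIdx_bijective u)

theorem exists_blkIdx_eq (k : Fin (∑ i, u i)) : ∃ i r, blkIdx u i r = k := by
  obtain ⟨⟨i, r⟩, h⟩ := (blkIdx_bijective u).2 k
  exact ⟨i, r, h⟩

/-- A family indexed by `Fin (∑ i, u i)` with prescribed blocks. -/
theorem exists_forall_blkIdx {X : Type*} (v : ∀ i, Fin (u i) → X) :
    ∃ V : Fin (∑ i, u i) → X, ∀ i r, V (blkIdx u i r) = v i r :=
  ⟨fun k => v ((blkEquiv u).symm k).1 ((blkEquiv u).symm k).2, fun i r => by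
    have : (blkEquiv u).symm (blkIdx u i r) = ⟨i, r⟩ :=
      (Equiv.symm_apply_eq _).2 rfl
    exact congrArg (fun x : Σ i, Fin (u i) => v x.1 x.2) this⟩

theorem sum_blkIdx (y : Fin (∑ i, u i) → ℕ) :
    ∑ k, y k = ∑ i, ∑ r, y (blkIdx u i r) := by
  rw [← (blkEquiv u).sum_comp, Fintype.sum_sigma]
  rfl

theorem sum_Iio_blkIdx (y : Fin (∑ i, u i) → ℕ) (i : Fin t) (r : Fin (u i)) :
    ∑ k ∈ Finset.Iio (blkIdx u i r), y k =
      ∑ i' ∈ Finset.Iio i, ∑ r', y (blkIdx u i' r') +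
        ∑ r' ∈ Finset.Iio r, y (blkIdx u i r') := by
  have h : ∑ k ∈ Finset.Iio (blkIdx u i r), y k =
      ∑ k, if k < blkIdx u i r then y k else 0 := by
    rw [← Finset.sum_filter]
    congr 1
    ext
    simp
  rw [h, sum_blkIdx, ← Finset.sum_subset (Finset.subset_univ (insert i (Finset.Iio i))),
    Finset.sum_insert (by simp), add_comm]
  · congr 1
    · refine Finset.sum_congr rfl fun i' hi' => Finset.sum_congr rfl fun r' _ => ?_
      rw [if_pos (blkIdx_lt_blkIdx_of_lt u (Finset.mem_Iio.1 hi') r' r)]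
    · simp only [blkIdx_lt_blkIdx_iff_same]
      rw [← Finset.sum_filter]
      congr 1
      ext
      simp
  · intro i' _ hi'
    simp only [Finset.mem_insert, Finset.mem_Iio, not_or, not_lt] at hi'
    refine Finset.sum_eq_zero fun r' _ => if_neg ?_
    exact (blkIdx_lt_blkIdx_of_lt u (lt_of_le_of_ne hi'.2 (Ne.symm hi'.1)) r r').le.not_gt

/-- Passing to a finer partition of the index set is compatible with passing to blocks. -/
theorem val_blkIdx_blkIdx (y : Fin (∑ i, u i) → ℕ) (i : Fin t) (r : Fin (u i))
    (s : Fin (y (blkIdx u i r))) :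
    (blkIdx (fun i => ∑ r, y (blkIdx u i r)) i (blkIdx (fun r => y (blkIdx u i r)) r s) : ℕ) =
      blkIdx y (blkIdx u i r) s := by
  simp only [blkIdx]
  have := sum_Iio_blkIdx u y i r
  simp only [blkIdx] at this
  omega

theorem transposePerm_blkIdx (p q : ℕ) (j : Fin p) (k : Fin q) :
    transposePerm p q (blkIdx (fun _ => q) j k) = blkIdx (fun _ => p) k j := by
  have h : finCongr (by simp) (blkIdx (fun _ : Fin p => q) j k) =
      finProdFinEquiv (j, k) := by
    ext
    simp [blkIdx, add_comm, mul_comm]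
  simp only [transposePerm, Equiv.trans_apply]
  rw [h, Equiv.symm_apply_apply]
  ext
  simp [blkIdx, add_comm, mul_comm]

theorem blkIdx_zero {m : ℕ} (n : Fin (m + 1) → ℕ) (s : Fin (n 0)) :
    blkIdx n 0 s = Fin.cast (Fin.sum_univ_succ n).symm (Fin.castAdd _ s) := by
  ext
  simp [blkIdx]

theorem blkIdx_succ {m : ℕ} (n : Fin (m + 1) → ℕ) (j : Fin m) (s : Fin (n j.succ)) :
    blkIdx n j.succ s = Fin.cast (Fin.sum_univ_succ n).symm
      (Fin.natAdd (n 0) (blkIdx (fun j => n j.succ) j s)) := by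
  have h : Finset.Iio j.succ = Finset.cons 0 ((Finset.Iio j).map (Fin.succEmb m)) (by simp) := by
    ext k
    induction k using Fin.cases <;> simp
  ext
  simp only [blkIdx, h, Finset.sum_cons, Finset.sum_map, Fin.coe_succEmb, add_assoc,
    Fin.val_cast, Fin.val_natAdd]

end BlockIndex

section BlockTensor

open PiTensorProduct

variable {R : Type*} [CommRing R] {H : Type*} [AddCommGroup H] [Module R H]

theorem tpCast_tprod {a b : ℕ} (h : a = b) (v : Fin a → H) :
    tpCast (R := R) h (tprod R v) = tprod R (v ∘ Fin.cast h.symm) :=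
  reindex_tprod _ _

@[simp]
theorem tpCast_tpCast {a b c : ℕ} (h : a = b) (h' : b = c) (x : ⨂[R]^a H) :
    tpCast h' (tpCast h x) = tpCast (h.trans h') x := by
  subst h h'
  simp [tpCast]

@[simp]
theorem tpCast_rfl {a : ℕ} (h : a = a) (x : ⨂[R]^a H) : tpCast h x = x := by
  simp [tpCast]

theorem splitPow_symm_tprod (a b : ℕ) (v : Fin a → H) (w : Fin b → H) :
    (splitPow (R := R) a b).symm (tprod R v ⊗ₜ tprod R w) = tprod R (Fin.append v w) :=
  TensorPower.tprod_mul_tprod R v w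

/-- The tensor product `w 0 ⊗ ⋯ ⊗ w (m-1)` of elements of tensor powers, as a multilinear map
with values in the tensor power of the total exponent. -/
noncomputable def blockTprod : ∀ {m : ℕ} (n : Fin m → ℕ),
    MultilinearMap R (fun j => ⨂[R]^(n j) H) (⨂[R]^(∑ j, n j) H)
  | 0, n => MultilinearMap.constOfIsEmpty R _ (tpCast (by simp) (tprod R (Fin.elim0 : Fin 0 → H)))
  | m + 1, n =>
      LinearMap.uncurryLeft
        { toFun := fun x =>
            ((tpCast (Fin.sum_univ_succ n).symm).toLinearMap
              ∘ₗ (splitPow (n 0) (∑ j : Fin m, n j.succ)).symm.toLinearMap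
              ∘ₗ TensorProduct.mk R _ _ x).compMultilinearMap (blockTprod fun j => n j.succ)
          map_add' := fun x x' => by ext; simp
          map_smul' := fun c x => by ext; simp }

theorem blockTprod_succ {m : ℕ} (n : Fin (m + 1) → ℕ) (w : ∀ j, ⨂[R]^(n j) H) :
    blockTprod n w = tpCast (Fin.sum_univ_succ n).symm
      ((splitPow (n 0) (∑ j : Fin m, n j.succ)).symm
        (w 0 ⊗ₜ blockTprod (fun j => n j.succ) fun j => w j.succ)) :=
  rfl

theorem blockMap_blockTprod {m : ℕ} (n g : Fin m → ℕ)
    (f : ∀ j, (⨂[R]^(n j) H) →ₗ[R] (⨂[R]^(g j) H)) (w : ∀ j, ⨂[R]^(n j) H) :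
    blockMap n g f (blockTprod n w) = blockTprod g fun j => f j (w j) := by
  induction m with
  | zero =>
    simp [blockMap, blockTprod]
  | succ m ih =>
    simp [blockMap, blockTprod_succ, ih]

theorem blockTprod_tprod {m : ℕ} (n : Fin m → ℕ) (V : Fin (∑ j, n j) → H) :
    blockTprod n (fun j => tprod R fun s => V (blkIdx n j s)) = tprod R V := by
  induction m with
  | zero =>
    simp only [blockTprod, MultilinearMap.constOfIsEmpty_apply, tpCast_tprod, Function.const_apply]
    refine congrArg (PiTensorProduct.tprod R) (funext fun k => ?_)
    exact (Fin.cast (by simp) k : Fin 0).elim0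
  | succ m ih =>
    simp only [blockTprod_succ, blkIdx_succ, blkIdx_zero]
    rw [ih (fun j => n j.succ)
      (fun k => V (Fin.cast (Fin.sum_univ_succ n).symm (Fin.natAdd (n 0) k))),
      splitPow_symm_tprod, tpCast_tprod]
    refine congrArg _ (funext fun k => ?_)
    obtain ⟨k, rfl⟩ := (finCongr (Fin.sum_univ_succ n).symm).surjective k
    induction k using Fin.addCases <;> simp

theorem sigmaPow_blockTprod (p q : ℕ) (h : Fin q → Fin p → H) :
    sigmaPow p q (blockTprod (fun _ => q) fun j => tprod R fun k => h k j) =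
      blockTprod (fun _ => p) fun k => tprod R fun j => h k j := by
  obtain ⟨V, hV⟩ := exists_forall_blkIdx (fun _ : Fin p => q) fun j k => h k j
  obtain ⟨W, hW⟩ := exists_forall_blkIdx (fun _ : Fin q => p) h
  have h1 := blockTprod_tprod (R := R) (fun _ : Fin p => q) V
  have h2 := blockTprod_tprod (R := R) (fun _ : Fin q => p) W
  simp only [hV] at h1
  simp only [hW] at h2
  rw [h1, h2]
  refine (reindex_tprod _ _).trans (congrArg _ (funext fun k => ?_))
  obtain ⟨k, j, rfl⟩ := exists_blkIdx_eq _ k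
  rw [← transposePerm_blkIdx, Equiv.symm_apply_apply, hV, transposePerm_blkIdx, hW]

theorem tpCast_blockTprod_tprod {m : ℕ} (n : Fin m → ℕ) (y : Fin (∑ j, n j) → ℕ)
    (V : Fin (∑ k, y k) → H) :
    tpCast (sum_blkIdx n y) (tprod R V) =
      blockTprod (fun j => ∑ s, y (blkIdx n j s)) fun j =>
        blockTprod (fun s => y (blkIdx n j s)) fun s =>
          tprod R fun t => V (blkIdx y (blkIdx n j s) t) := by
  have h : ∀ j s t, V (blkIdx y (blkIdx n j s) t) = (V ∘ Fin.cast (sum_blkIdx n y).symm)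
      (blkIdx (fun j => ∑ s, y (blkIdx n j s)) j (blkIdx (fun s => y (blkIdx n j s)) s t)) := by
    intro j s t
    refine congrArg V (Fin.ext ?_)
    exact (val_blkIdx_blkIdx n y j s t).symm
  rw [tpCast_tprod, ← blockTprod_tprod (fun j => ∑ s, y (blkIdx n j s))]
  congr 1
  ext j
  simp only [h]
  exact (blockTprod_tprod (fun s => y (blkIdx n j s)) _).symm

theorem multilinear_ext_tprod {ι : Type*} [Finite ι] {β : ι → ℕ} {E : Type*} [AddCommGroup E]
    [Module R E] {F G : MultilinearMap R (fun i => ⨂[R]^(β i) H) E}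
    (h : ∀ v : ∀ i, Fin (β i) → H,
      F (fun i => tprod R (v i)) = G (fun i => tprod R (v i))) : F = G :=
  MultilinearMap.ext_of_span_eq_top (g := fun i (v : Fin (β i) → H) => PiTensorProduct.tprod R v)
    (fun _ => span_tprod_eq_top) h

/-- Associativity of the tensor product of families of elements of tensor powers. -/
theorem tpCast_blockTprod {m : ℕ} (n : Fin m → ℕ) (y : Fin (∑ j, n j) → ℕ)
    (w : ∀ k, ⨂[R]^(y k) H) :
    tpCast (sum_blkIdx n y) (blockTprod y w) =
      blockTprod (fun j => ∑ s, y (blkIdx n j s)) fun j =>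
        blockTprod (fun s => y (blkIdx n j s)) fun s => w (blkIdx n j s) := by
  let F : MultilinearMap R (fun x : Σ j, Fin (n j) => ⨂[R]^(y (blkIdx n x.1 x.2)) H) _ :=
    (tpCast (sum_blkIdx n y)).toLinearMap.compMultilinearMap
      (MultilinearMap.domDomCongrLinearEquiv' R R (fun k => ⨂[R]^(y k) H) _ (blkEquiv n).symm
        (blockTprod y))
  let G : MultilinearMap R (fun x : Σ j, Fin (n j) => ⨂[R]^(y (blkIdx n x.1 x.2)) H) _ :=
    MultilinearMap.compMultilinearMap (N := fun j s => ⨂[R]^(y (blkIdx n j s)) H)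
      (blockTprod (R := R) (H := H) fun j => ∑ s, y (blkIdx n j s))
      (fun j => blockTprod fun s => y (blkIdx n j s))
  have hF : ∀ w : ∀ k, ⨂[R]^(y k) H, F (fun x => w (blkIdx n x.1 x.2)) =
      tpCast (sum_blkIdx n y) (blockTprod y w) := fun w =>
    congrArg (fun w => tpCast (sum_blkIdx n y) (blockTprod y w))
      (((blkEquiv n).symm.piCongrLeft' fun k => ⨂[R]^(y k) H).symm_apply_apply w)
  have hFG : F = G := by
    refine multilinear_ext_tprod fun v => ?_
    obtain ⟨v, rfl⟩ := ((blkEquiv n).symm.piCongrLeft' fun k => Fin (y k) → H).surjective v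
    obtain ⟨V, hV⟩ := exists_forall_blkIdx y v
    obtain rfl : v = fun k t => V (blkIdx y k t) := by ext; simp [hV]
    refine (hF fun k => tprod R fun t => V (blkIdx y k t)).trans ?_
    rw [blockTprod_tprod, tpCast_blockTprod_tprod]
    rfl
  rw [← hF, hFG]
  rfl

theorem linearMap_ext_blockTprod {m : ℕ} (n : Fin m → ℕ) {E : Type*} [AddCommGroup E]
    [Module R E] {F G : (⨂[R]^(∑ j, n j) H) →ₗ[R] E}
    (h : ∀ v : ∀ j, Fin (n j) → H, F (blockTprod n fun j => tprod R (v j)) =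
      G (blockTprod n fun j => tprod R (v j))) : F = G := by
  ext V
  have := h fun j s => V (blkIdx n j s)
  rwa [blockTprod_tprod] at this

theorem tpCast_blockMap {m : ℕ} (n : Fin m → ℕ) (x y : Fin (∑ j, n j) → ℕ)
    (f : ∀ k, (⨂[R]^(x k) H) →ₗ[R] (⨂[R]^(y k) H)) (z : ⨂[R]^(∑ k, x k) H) :
    tpCast (sum_blkIdx n y) (blockMap x y f z) =
      blockMap (fun j => ∑ s, x (blkIdx n j s)) (fun j => ∑ s, y (blkIdx n j s))
        (fun j => blockMap _ _ fun s => f (blkIdx n j s)) (tpCast (sum_blkIdx n x) z) := by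
  refine LinearMap.congr_fun (f := (tpCast (sum_blkIdx n y)).toLinearMap ∘ₗ blockMap x y f)
    (g := blockMap _ _ _ ∘ₗ (tpCast (sum_blkIdx n x)).toLinearMap) ?_ z
  refine linearMap_ext_blockTprod x fun v => ?_
  simp [blockMap_blockTprod, tpCast_blockTprod]

/-- Interchanging a tensor product over `p` columns with a tensor product over rows grouped into
blocks of sizes `m r` can be done block by block. -/
theorem sigmaPow_blockTprod_blockTprod (p : ℕ) {q : ℕ} (m : Fin q → ℕ)
    (g : ∀ r, Fin p → ⨂[R]^(m r) H) :
    tpCast (sum_blkIdx m fun _ => p)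
      (sigmaPow p (∑ r, m r) (blockTprod (fun _ => ∑ r, m r) fun j => blockTprod m fun r => g r j)) =
      blockTprod (fun r => ∑ _ : Fin (m r), p) fun r =>
        sigmaPow p (m r) (blockTprod (fun _ => m r) fun j => g r j) := by
  let F : MultilinearMap R (fun x : Σ _ : Fin q, Fin p => ⨂[R]^(m x.1) H) _ :=
    ((tpCast (sum_blkIdx m fun _ => p)).toLinearMap
      ∘ₗ (sigmaPow p (∑ r, m r)).toLinearMap).compMultilinearMap
      (MultilinearMap.domDomCongrLinearEquiv' R R
        (fun x : Σ _ : Fin p, Fin q => ⨂[R]^(m x.2) H) _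
        ((Equiv.sigmaEquivProd _ _).trans
          ((Equiv.prodComm _ _).trans (Equiv.sigmaEquivProd _ _).symm))
        (MultilinearMap.compMultilinearMap (N := fun _ r => ⨂[R]^(m r) H)
          (blockTprod (R := R) (H := H) fun _ : Fin p => ∑ r, m r)
          (fun _ => blockTprod m)))
  let G : MultilinearMap R (fun x : Σ _ : Fin q, Fin p => ⨂[R]^(m x.1) H) _ :=
    MultilinearMap.compMultilinearMap (N := fun r _ => ⨂[R]^(m r) H)
      (blockTprod (R := R) (H := H) fun r => ∑ _ : Fin (m r), p)
      (fun r => (sigmaPow p (m r)).toLinearMap.compMultilinearMap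
        (blockTprod fun _ : Fin p => m r))
  have hF : ∀ g : ∀ r, Fin p → ⨂[R]^(m r) H, F (fun x => g x.1 x.2) =
      tpCast (sum_blkIdx m fun _ => p) (sigmaPow p (∑ r, m r)
        (blockTprod (fun _ => ∑ r, m r) fun j => blockTprod m fun r => g r j)) :=
    fun g => rfl
  have hFG : F = G := by
    refine multilinear_ext_tprod fun v => ?_
    obtain ⟨h, hh⟩ := exists_forall_blkIdx m fun r s => fun j : Fin p => v ⟨r, j⟩ s
    obtain rfl : v = fun x s => h (blkIdx m x.1 s) x.2 := by ext; simp [hh]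
    refine (hF fun r j => tprod R fun s => h (blkIdx m r s) j).trans ?_
    have h1 : ∀ j, (blockTprod m fun r => tprod R fun s => h (blkIdx m r s) j) =
        tprod R fun k => h k j := fun j => blockTprod_tprod m fun k => h k j
    simp only [h1]
    rw [sigmaPow_blockTprod, tpCast_blockTprod]
    refine congrArg _ (funext fun r => ?_)
    exact (sigmaPow_blockTprod p (m r) fun s j => h (blkIdx m r s) j).symm
  rw [← hF, hFG]
  rfl

theorem gammaTP_blockTprod {p q : ℕ} (x : Fin p → ℕ) (y : Fin q → ℕ)
    (A : ∀ k, (⨂[R]^p H) →ₗ[R] (⨂[R]^(y k) H)) (B : ∀ j, (⨂[R]^(x j) H) →ₗ[R] (⨂[R]^q H))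
    (w : ∀ j, ⨂[R]^(x j) H) :
    gammaTP x y A B (blockTprod x w) =
      blockMap (fun _ => p) y A (sigmaPow p q (blockTprod (fun _ => q) fun j => B j (w j))) := by
  simp [gammaTP, blockMap_blockTprod]

/-- Both sides of associativity of `γ`, before precomposition with the innermost family of maps. -/
theorem blockMap_gammaTP_sigmaPow {p q : ℕ} (n : Fin p → ℕ) (m : Fin q → ℕ)
    (y : Fin (∑ r, m r) → ℕ)
    (a : ∀ k, (⨂[R]^p H) →ₗ[R] (⨂[R]^(y k) H))
    (b : ∀ r j, (⨂[R]^(n j) H) →ₗ[R] (⨂[R]^(m r) H))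
    (z : ⨂[R]^(∑ _ : Fin (∑ j, n j), q) H) :
    blockMap (fun _ => ∑ j, n j) (fun r => ∑ s, y (blkIdx m r s))
        (fun r => gammaTP n (fun s => y (blkIdx m r s)) (fun s => a (blkIdx m r s)) (b r))
        (sigmaPow (∑ j, n j) q z) =
      tpCast (sum_blkIdx m y) (blockMap (fun _ => p) y a (sigmaPow p (∑ r, m r)
        (blockMap (fun j => ∑ _ : Fin (n j), q) (fun _ => ∑ r, m r)
          (fun j => blockMap (fun _ => n j) m (fun r => b r j) ∘ₗ (sigmaPow (n j) q).toLinearMap)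
          (tpCast (sum_blkIdx n fun _ => q) z)))) := by
  refine LinearMap.congr_fun (f := blockMap _ _ _ ∘ₗ (sigmaPow (∑ j, n j) q).toLinearMap)
    (g := (tpCast (sum_blkIdx m y)).toLinearMap ∘ₗ blockMap _ _ _
      ∘ₗ (sigmaPow p (∑ r, m r)).toLinearMap ∘ₗ blockMap _ _ _
      ∘ₗ (tpCast (sum_blkIdx n fun _ => q)).toLinearMap) ?_ z
  refine linearMap_ext_blockTprod _ fun v => ?_
  simp only [LinearMap.comp_apply, LinearEquiv.coe_coe]
  have h1 := sigmaPow_blockTprod (R := R) (∑ j, n j) q fun r k => v k r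
  have h2 : ∀ j, sigmaPow (n j) q (blockTprod (fun _ => q) fun t =>
      PiTensorProduct.tprod R (v (blkIdx n j t))) =
      blockTprod (fun _ => n j) fun r => PiTensorProduct.tprod R fun t => v (blkIdx n j t) r :=
    fun j => sigmaPow_blockTprod (n j) q fun r t => v (blkIdx n j t) r
  have h3 : ∀ r, PiTensorProduct.tprod R (fun k => v k r) =
      blockTprod n fun j => PiTensorProduct.tprod R fun t => v (blkIdx n j t) r :=
    fun r => (blockTprod_tprod n fun k => v k r).symm
  rw [h1, tpCast_blockTprod, blockMap_blockTprod, blockMap_blockTprod]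
  simp only [h3, LinearMap.comp_apply, LinearEquiv.coe_coe, h2, gammaTP_blockTprod,
    blockMap_blockTprod]
  rw [tpCast_blockMap, sigmaPow_blockTprod_blockTprod p m fun r j =>
    b r j (PiTensorProduct.tprod R fun t => v (blkIdx n j t) r), blockMap_blockTprod]

/-- Associativity of the composition product `γ`. -/
theorem gammaTP_assoc {p q : ℕ} (n : Fin p → ℕ) (m : Fin q → ℕ)
    (x : Fin (∑ j, n j) → ℕ) (y : Fin (∑ r, m r) → ℕ)
    (a : ∀ k, (⨂[R]^p H) →ₗ[R] (⨂[R]^(y k) H))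
    (b : ∀ r j, (⨂[R]^(n j) H) →ₗ[R] (⨂[R]^(m r) H))
    (c : ∀ k, (⨂[R]^(x k) H) →ₗ[R] (⨂[R]^q H)) :
    gammaTP x (fun r => ∑ s, y (blkIdx m r s))
        (fun r => gammaTP n (fun s => y (blkIdx m r s)) (fun s => a (blkIdx m r s)) (b r)) c =
      (tpCast (sum_blkIdx m y)).toLinearMap
        ∘ₗ gammaTP (fun j => ∑ t, x (blkIdx n j t)) y a
          (fun j => gammaTP (fun t => x (blkIdx n j t)) m (fun r => b r j)
            (fun t => c (blkIdx n j t)))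
        ∘ₗ (tpCast (sum_blkIdx n x)).toLinearMap := by
  refine linearMap_ext_blockTprod x fun v => ?_
  simp only [LinearMap.comp_apply, LinearEquiv.coe_coe]
  rw [gammaTP_blockTprod, blockMap_gammaTP_sigmaPow, tpCast_blockTprod n (fun _ => q),
    tpCast_blockTprod n x, gammaTP_blockTprod, blockMap_blockTprod]
  simp only [gammaTP_blockTprod, LinearMap.comp_apply, LinearEquiv.coe_coe]

end BlockTensor

section Upsilon

variable {R : Type*} [CommRing R] {H : Type*} [AddCommGroup H] [Module R H]

/-- `gammaTP_assoc` for families that are only propositionally equal to the blocks of `a`, `c`. -/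
theorem gammaTP_assoc_of_heq {p q : ℕ} {n : Fin p → ℕ} {m : Fin q → ℕ}
    {x : Fin (∑ j, n j) → ℕ} {y : Fin (∑ r, m r) → ℕ}
    {x' : ∀ j, Fin (n j) → ℕ} {y' : ∀ r, Fin (m r) → ℕ}
    (hx : ∀ j t, x' j t = x (blkIdx n j t)) (hy : ∀ r s, y' r s = y (blkIdx m r s))
    (a : ∀ k, (⨂[R]^p H) →ₗ[R] (⨂[R]^(y k) H))
    (a' : ∀ r s, (⨂[R]^p H) →ₗ[R] (⨂[R]^(y' r s) H))
    (ha : ∀ r s, a' r s ≍ a (blkIdx m r s))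
    (b : ∀ r j, (⨂[R]^(n j) H) →ₗ[R] (⨂[R]^(m r) H))
    (c : ∀ k, (⨂[R]^(x k) H) →ₗ[R] (⨂[R]^q H))
    (c' : ∀ j t, (⨂[R]^(x' j t) H) →ₗ[R] (⨂[R]^q H))
    (hc : ∀ j t, c' j t ≍ c (blkIdx n j t))
    (hx' : ∑ k, x k = ∑ j, ∑ t, x' j t) (hy' : ∑ k, y k = ∑ r, ∑ s, y' r s) :
    gammaTP x (fun r => ∑ s, y' r s) (fun r => gammaTP n (y' r) (a' r) (b r)) c =
      (tpCast hy').toLinearMap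
        ∘ₗ gammaTP (fun j => ∑ t, x' j t) y a
          (fun j => gammaTP (x' j) m (fun r => b r j) (c' j))
        ∘ₗ (tpCast hx').toLinearMap := by
  obtain rfl : x' = fun j t => x (blkIdx n j t) := funext fun j => funext (hx j)
  obtain rfl : y' = fun r s => y (blkIdx m r s) := funext fun r => funext (hy r)
  obtain rfl : a' = fun r s => a (blkIdx m r s) :=
    funext fun r => funext fun s => eq_of_heq (ha r s)
  obtain rfl : c' = fun j t => c (blkIdx n j t) :=
    funext fun j => funext fun t => eq_of_heq (hc j t)
  exact gammaTP_assoc n m x y a b c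

theorem monD_eq {p q : ℕ} {x x' : Fin p → ℕ} {y y' : Fin q → ℕ} (hx : ∀ j, x j = x' j)
    (hy : ∀ k, y' k = y k) {M : Mon' R H ⟨p, x⟩ ⟨q, y⟩} {M' : Mon' R H ⟨p, x'⟩ ⟨q, y'⟩}
    (h : ∀ k j, M k j = (tpCast (hy k)).toLinearMap ∘ₗ M' k j ∘ₗ (tpCast (hx j)).toLinearMap) :
    (⟨⟨p, x⟩, ⟨q, y⟩, M⟩ : MonD R H) = ⟨⟨p, x'⟩, ⟨q, y'⟩, M'⟩ := by
  obtain rfl : x = x' := funext hx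
  obtain rfl : y' = y := funext hy
  obtain rfl : M = M' := by
    ext1 k
    ext1 j
    refine (h k j).trans (LinearMap.ext fun v => ?_)
    simp only [LinearMap.comp_apply, LinearEquiv.coe_coe, tpCast_rfl]
  rfl

/-- The condition for two monomials to form a block transverse pair. -/
def IsBTP (a b : MonD R H) : Prop :=
  a.2.1.1 = ∑ i, b.2.1.2 i ∧ b.1.1 = ∑ l, a.1.2 l

/-- The upsilon product of a block transverse pair. -/
noncomputable def upsBTP (a b : MonD R H) (h : IsBTP a b) : MonD R H :=
  ⟨⟨a.1.1, fun l => ∑ j : Fin (a.1.2 l), b.1.2 (Fin.cast h.2.symm (blkIdx a.1.2 l j))⟩,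
    ⟨b.2.1.1, fun i => ∑ r : Fin (b.2.1.2 i), a.2.1.2 (Fin.cast h.1.symm (blkIdx b.2.1.2 i r))⟩,
    fun i l => gammaTP
      (fun j => b.1.2 (Fin.cast h.2.symm (blkIdx a.1.2 l j)))
      (fun r => a.2.1.2 (Fin.cast h.1.symm (blkIdx b.2.1.2 i r)))
      (fun r => a.2.2 (Fin.cast h.1.symm (blkIdx b.2.1.2 i r)) l)
      (fun j => b.2.2 i (Fin.cast h.2.symm (blkIdx a.1.2 l j)))⟩

theorem upsM_of_isBTP {a b : MonD R H} (h : IsBTP a b) : upsM a b = some (upsBTP a b h) :=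
  dif_pos h

theorem upsM_of_not_isBTP {a b : MonD R H} (h : ¬IsBTP a b) : upsM a b = none :=
  dif_neg h

theorem isBTP_upsBTP_left {a b c : MonD R H} (h : IsBTP a b) :
    IsBTP (upsBTP a b h) c ↔ IsBTP b c := by
  obtain ⟨⟨pa, xa⟩, ⟨qa, ya⟩, A⟩ := a
  obtain ⟨⟨pb, xb⟩, ⟨qb, yb⟩, B⟩ := b
  obtain ⟨rfl, rfl⟩ : qa = ∑ i, yb i ∧ pb = ∑ l, xa l := h
  exact and_congr_right' (Eq.congr_right (sum_blkIdx xa xb).symm)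

theorem isBTP_upsBTP_right {a b c : MonD R H} (h : IsBTP b c) :
    IsBTP a (upsBTP b c h) ↔ IsBTP a b := by
  obtain ⟨⟨pb, xb⟩, ⟨qb, yb⟩, B⟩ := b
  obtain ⟨⟨pc, xc⟩, ⟨qc, yc⟩, C⟩ := c
  obtain ⟨rfl, rfl⟩ : qb = ∑ i, yc i ∧ pc = ∑ l, xb l := h
  exact and_congr_left' (Eq.congr_right (sum_blkIdx yc yb).symm)

theorem upsBTP_assoc {a b c : MonD R H} (hab : IsBTP a b) (hbc : IsBTP b c) :
    upsBTP (upsBTP a b hab) c ((isBTP_upsBTP_left hab).2 hbc) =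
      upsBTP a (upsBTP b c hbc) ((isBTP_upsBTP_right hbc).2 hab) := by
  obtain ⟨⟨pa, xa⟩, ⟨qa, ya⟩, A⟩ := a
  obtain ⟨⟨pb, xb⟩, ⟨qb, yb⟩, B⟩ := b
  obtain ⟨⟨pc, xc⟩, ⟨qc, yc⟩, C⟩ := c
  obtain ⟨rfl, rfl⟩ : qa = ∑ i, yb i ∧ pb = ∑ l, xa l := hab
  obtain ⟨rfl, rfl⟩ : qb = ∑ i, yc i ∧ pc = ∑ l, xb l := hbc
  have hyi : ∀ (i) (r) (s : Fin (yb (blkIdx yc i r))), blkIdx yb (blkIdx yc i r) s =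
      Fin.cast (sum_blkIdx yc yb).symm (blkIdx (fun i => ∑ r, yb (blkIdx yc i r)) i
        (blkIdx (fun r => yb (blkIdx yc i r)) r s)) :=
    fun i r s => Fin.ext (val_blkIdx_blkIdx yc yb i r s).symm
  have hxl : ∀ (l) (j) (t : Fin (xb (blkIdx xa l j))), blkIdx xb (blkIdx xa l j) t =
      Fin.cast (sum_blkIdx xa xb).symm (blkIdx (fun l => ∑ j, xb (blkIdx xa l j)) l
        (blkIdx (fun j => xb (blkIdx xa l j)) j t)) :=
    fun l j t => Fin.ext (val_blkIdx_blkIdx xa xb l j t).symm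
  have hX : ∀ l, ∑ k, xc (Fin.cast (sum_blkIdx xa xb).symm
        (blkIdx (fun l => ∑ j, xb (blkIdx xa l j)) l k)) =
      ∑ j, ∑ t, xc (blkIdx xb (blkIdx xa l j) t) := by
    intro l
    simp only [hxl]
    exact sum_blkIdx (fun j => xb (blkIdx xa l j)) _
  have hY : ∀ i, ∑ k, ya (Fin.cast (sum_blkIdx yc yb).symm
        (blkIdx (fun i => ∑ r, yb (blkIdx yc i r)) i k)) =
      ∑ r, ∑ s, ya (blkIdx yb (blkIdx yc i r) s) := by
    intro i
    simp only [hyi]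
    exact sum_blkIdx (fun r => yb (blkIdx yc i r)) _
  refine monD_eq hX hY fun i l => ?_
  exact gammaTP_assoc_of_heq (n := fun j => xb (blkIdx xa l j))
    (m := fun r => yb (blkIdx yc i r))
    (x := fun k => xc (Fin.cast (sum_blkIdx xa xb).symm
      (blkIdx (fun l => ∑ j, xb (blkIdx xa l j)) l k)))
    (y := fun k => ya (Fin.cast (sum_blkIdx yc yb).symm
      (blkIdx (fun i => ∑ r, yb (blkIdx yc i r)) i k)))
    (x' := fun j t => xc (blkIdx xb (blkIdx xa l j) t))
    (y' := fun r s => ya (blkIdx yb (blkIdx yc i r) s))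
    (fun j t => congrArg xc (hxl l j t)) (fun r s => congrArg ya (hyi i r s))
    (fun k => A (Fin.cast (sum_blkIdx yc yb).symm
      (blkIdx (fun i => ∑ r, yb (blkIdx yc i r)) i k)) l)
    (fun r s => A (blkIdx yb (blkIdx yc i r) s) l)
    (fun r s => congr_arg_heq (fun k => A k l) (hyi i r s))
    (fun r j => B (blkIdx yc i r) (blkIdx xa l j))
    (fun k => C i (Fin.cast (sum_blkIdx xa xb).symm
      (blkIdx (fun l => ∑ j, xb (blkIdx xa l j)) l k)))
    (fun j t => C i (blkIdx xb (blkIdx xa l j) t))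
    (fun j t => congr_arg_heq (fun k => C i k) (hxl l j t)) (hX l) (hY i)

theorem upsO_assoc (a b c : MonD R H) :
    upsO (upsO (some a) (some b)) (some c) = upsO (some a) (upsO (some b) (some c)) := by
  simp only [upsO, Option.bind_some]
  by_cases hab : IsBTP a b <;> by_cases hbc : IsBTP b c
  · rw [upsM_of_isBTP hab, upsM_of_isBTP hbc, Option.bind_some, Option.bind_some,
      upsM_of_isBTP ((isBTP_upsBTP_left hab).2 hbc),
      upsM_of_isBTP ((isBTP_upsBTP_right hbc).2 hab), upsBTP_assoc hab hbc]
  · rw [upsM_of_isBTP hab, upsM_of_not_isBTP hbc, Option.bind_some, Option.bind_none,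
      upsM_of_not_isBTP ((isBTP_upsBTP_left hab).not.2 hbc)]
  · rw [upsM_of_not_isBTP hab, upsM_of_isBTP hbc, Option.bind_some, Option.bind_none,
      upsM_of_not_isBTP ((isBTP_upsBTP_right hbc).not.2 hab)]
  · rw [upsM_of_not_isBTP hab, upsM_of_not_isBTP hbc, Option.bind_none, Option.bind_none]

end Upsilon

theorem upsilon_associative
    {R : Type*} [CommRing R] {H : Type*} [AddCommGroup H] [Module R H]
    (a b c : MonD R H)
    (ha1 : a.1.Pos) (ha2 : a.2.1.Pos) (hb1 : b.1.Pos) (hb2 : b.2.1.Pos)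
    (hc1 : c.1.Pos) (hc2 : c.2.1.Pos) :
    toU (upsO (upsO (some a) (some b)) (some c)) =
      toU (upsO (some a) (upsO (some b) (some c))) := by
  rw [upsO_assoc]
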